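/- arXiv:math/0306186 — 2 statements merged into one kernel-verified Lean document; each statement's English description precedes it below -/
import Mathlib

section
/- Assume e ≥ 3 and n ≥ 2. In the BMR monoid (the monoid presented by the BMR generators and relations), the words 1·3·2·1·3·⟨21⟩^{e−2} and 3·2·1·3·⟨21⟩^{e−1} become equal after left multiplication by 2 — that is, 2·1·3·2·1·3·⟨21⟩^{e−2} = 2·3·2·1·3·⟨21⟩^{e−1} holds in the monoid — yet they represent distinct elements of the monoid. Hence the BMR monoid is not left cancellative, and the natural homomorphism from the BMR monoid to the BMR-presented braid group B(e,e,n+1) is not injective. -/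
namespace BMR

/-- The BMR generating set: `t1 = τ'_2`, `t2 = τ_2`, and `s i = τ_{i+3}` for `i < n-1`. -/
inductive Gen (n : ℕ) : Type
  | t1 : Gen n
  | t2 : Gen n
  | s : Fin (n - 1) → Gen n

/-- `alt a b k` is the alternating product `a b a b ⋯` with `k` factors. -/
def alt {M : Type*} [Monoid M] : M → M → ℕ → M
  | _, _, 0 => 1
  | a, b, k + 1 => a * alt b a k

open FreeMonoid in
/-- The BMR relations for the braid group `B(e,e,n+1)`. -/
inductive Rel (e n : ℕ) : FreeMonoid (Gen n) → FreeMonoid (Gen n) → Prop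
  | comm_ss (i j : Fin (n - 1)) (h : (i : ℕ) + 2 ≤ (j : ℕ)) :
      Rel e n (of (Gen.s i) * of (Gen.s j)) (of (Gen.s j) * of (Gen.s i))
  | comm_t1s (j : Fin (n - 1)) (h : 1 ≤ (j : ℕ)) :
      Rel e n (of Gen.t1 * of (Gen.s j)) (of (Gen.s j) * of Gen.t1)
  | alt_rel :
      Rel e n (alt (of Gen.t2) (of Gen.t1) e) (alt (of Gen.t1) (of Gen.t2) e)
  | braid_t2 (h : 0 < n - 1) :
      Rel e n (of Gen.t2 * of (Gen.s ⟨0, h⟩) * of Gen.t2)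
        (of (Gen.s ⟨0, h⟩) * of Gen.t2 * of (Gen.s ⟨0, h⟩))
  | braid_ss (i : Fin (n - 1)) (h : (i : ℕ) + 1 < n - 1) :
      Rel e n (of (Gen.s i) * of (Gen.s ⟨(i : ℕ) + 1, h⟩) * of (Gen.s i))
        (of (Gen.s ⟨(i : ℕ) + 1, h⟩) * of (Gen.s i) * of (Gen.s ⟨(i : ℕ) + 1, h⟩))
  | braid_t1 (h : 0 < n - 1) :
      Rel e n (of Gen.t1 * of (Gen.s ⟨0, h⟩) * of Gen.t1)
        (of (Gen.s ⟨0, h⟩) * of Gen.t1 * of (Gen.s ⟨0, h⟩))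
  | long (h : 0 < n - 1) :
      Rel e n (of (Gen.s ⟨0, h⟩) * of Gen.t2 * of Gen.t1 * of (Gen.s ⟨0, h⟩) * of Gen.t2 * of Gen.t1)
        (of Gen.t2 * of Gen.t1 * of (Gen.s ⟨0, h⟩) * of Gen.t2 * of Gen.t1 * of (Gen.s ⟨0, h⟩))

/-- The BMR monoid: the monoid presented by the BMR generators and relations. -/
abbrev Mon (e n : ℕ) : Type := (conGen (Rel e n)).Quotient

/-- The canonical projection from the free monoid onto the BMR monoid. -/
def mk (e n : ℕ) : FreeMonoid (Gen n) →* Mon e n := Con.mk' _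

/-- The canonical monoid map from the free monoid on the generators to the free group. -/
def toFG (n : ℕ) : FreeMonoid (Gen n) →* FreeGroup (Gen n) :=
  FreeMonoid.lift FreeGroup.of

/-- The group relators associated with a set of positive relations. -/
def relsOf (n : ℕ) (R : Set (FreeMonoid (Gen n) × FreeMonoid (Gen n))) :
    Set (FreeGroup (Gen n)) :=
  {x | ∃ p ∈ R, x = toFG n p.1 * (toFG n p.2)⁻¹}

/-- The group relators associated with the BMR relations. -/
def grels (e n : ℕ) : Set (FreeGroup (Gen n)) :=
  {x | ∃ u v, Rel e n u v ∧ x = toFG n u * (toFG n v)⁻¹}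

/-- The BMR-presented braid group `B(e,e,n+1)`. -/
abbrev Grp (e n : ℕ) : Type := PresentedGroup (grels e n)

/-- The natural map from positive words to the BMR braid group. -/
def mkG (e n : ℕ) : FreeMonoid (Gen n) →* Grp e n :=
  FreeMonoid.lift (fun g => (PresentedGroup.of g : Grp e n))


/-- The word `1` (= `τ'_2`). -/
def oT1 (n : ℕ) : FreeMonoid (Gen n) := FreeMonoid.of Gen.t1
/-- The word `2` (= `τ_2`). -/
def oT2 (n : ℕ) : FreeMonoid (Gen n) := FreeMonoid.of Gen.t2
/-- The word `3` (= `τ_3`). -/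
def oS0 (n : ℕ) (h : 0 < n - 1) : FreeMonoid (Gen n) := FreeMonoid.of (Gen.s ⟨0, h⟩)

/-- The word `1·3·2·1·3·⟨21⟩^{e-2}`. -/
def w1 (e n : ℕ) (h : 0 < n - 1) : FreeMonoid (Gen n) :=
  oT1 n * oS0 n h * oT2 n * oT1 n * oS0 n h * alt (oT2 n) (oT1 n) (e - 2)

/-- The word `3·2·1·3·⟨21⟩^{e-1}`. -/
def w2 (e n : ℕ) (h : 0 < n - 1) : FreeMonoid (Gen n) :=
  oS0 n h * oT2 n * oT1 n * oS0 n h * alt (oT2 n) (oT1 n) (e - 1)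

theorem map_alt {M N : Type*} [Monoid M] [Monoid N] (f : M →* N) (a b : M) (k : ℕ) :
    f (alt a b k) = alt (f a) (f b) k := by
  induction k generalizing a b with
  | zero => exact map_one f
  | succ k ih => simp [alt, ih]

theorem alt_add_two {M : Type*} [Monoid M] (a b : M) (k : ℕ) :
    alt a b (k + 2) = a * b * alt a b k := by
  simp [alt, mul_assoc]

theorem mk_eq_of_rel {e n : ℕ} {u v : FreeMonoid (Gen n)} (h : Rel e n u v) :
    mk e n u = mk e n v :=
  (Con.eq _).2 (ConGen.Rel.of _ _ h)

/-- Left multiplication by `2` identifies the two words. -/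
theorem mk_two_mul_w1_eq (e n : ℕ) (he : 2 ≤ e) (h0 : 0 < n - 1) :
    mk e n (oT2 n * w1 e n h0) = mk e n (oT2 n * w2 e n h0) := by
  have halt := mk_eq_of_rel (Rel.alt_rel (e := e) (n := n))
  have hb2 := mk_eq_of_rel (Rel.braid_t2 (e := e) h0)
  have hb1 := mk_eq_of_rel (Rel.braid_t1 (e := e) h0)
  have hlong := mk_eq_of_rel (Rel.long (e := e) h0)
  obtain ⟨k, rfl⟩ := Nat.exists_eq_add_of_le' he
  simp only [w1, w2, oT1, oT2, oS0, map_mul, map_alt, Nat.add_sub_cancel,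
    show k + 2 - 1 = k + 1 by lia] at *
  generalize mk (k + 2) n (FreeMonoid.of Gen.t1) = a at *
  generalize mk (k + 2) n (FreeMonoid.of Gen.t2) = b at *
  generalize mk (k + 2) n (FreeMonoid.of (Gen.s ⟨0, h0⟩)) = c at *
  calc b * (a * c * b * a * c * alt b a k)
      = (b * a * c * b * a * c) * alt b a k := by simp only [mul_assoc]
    _ = c * b * a * c * alt b a (k + 2) := by
        rw [← hlong, alt_add_two]; simp only [mul_assoc]
    _ = c * b * (a * c * a) * alt b a (k + 1) := by
        rw [halt, alt]; simp only [mul_assoc]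
    _ = (c * b * c) * (a * c * alt b a (k + 1)) := by
        rw [hb1]; simp only [mul_assoc]
    _ = b * (c * b * a * c * alt b a (k + 1)) := by
        rw [← hb2]; simp only [mul_assoc]

/-- States of an automaton reading the words `⟨12⟩^j 3213 ⟨21⟩^k` with `j` odd and `j + k < e`.
The argument `m` counts the letters `1` and `2` read outside the factor `3213`; the Boolean in
`run` says whether that factor has been read, and `mid₁`, `mid₂`, `mid₃` are reached after
reading `3`, `32`, `321`. -/
inductive State : Type
  | sink : State
  | run : Bool → ℕ → State
  | mid₁ : ℕ → State
  | mid₂ : ℕ → State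
  | mid₃ : ℕ → State

/-- The transition function of the automaton. -/
def step (e n : ℕ) : Gen n → State → State
  | .t1, .run b m => if m % 2 = 0 ∧ m + 1 < e then .run b (m + 1) else .sink
  | .t2, .run b m => if m % 2 = 1 ∧ m + 1 < e then .run b (m + 1) else .sink
  | .t2, .mid₁ m => .mid₂ m
  | .t1, .mid₂ m => .mid₃ m
  | .s i, .run false m => if (i : ℕ) = 0 ∧ m % 2 = 1 then .mid₁ m else .sink
  | .s i, .mid₃ m => if (i : ℕ) = 0 ∧ m % 2 = 1 then .run true m else .sink
  | _, _ => .sink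

/-- The right action of words on the states of the automaton. -/
def act (e n : ℕ) : FreeMonoid (Gen n) →* (Function.End State)ᵐᵒᵖ :=
  FreeMonoid.lift fun g => MulOpposite.op (step e n g)

/-- The state reached from `q` after reading the word `w`. -/
def read (e n : ℕ) (w : FreeMonoid (Gen n)) (q : State) : State :=
  (act e n w).unop q

section read

variable {e n : ℕ}

theorem read_one (q : State) : read e n 1 q = q :=
  rfl

theorem read_of (g : Gen n) (q : State) : read e n (FreeMonoid.of g) q = step e n g q :=
  rfl

theorem read_mul (u v : FreeMonoid (Gen n)) (q : State) :
    read e n (u * v) q = read e n v (read e n u q) := by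
  rw [read, map_mul]
  rfl

theorem step_sink (g : Gen n) : step e n g .sink = .sink := by
  cases g <;> rfl

theorem step_s_of_pos {i : Fin (n - 1)} (hi : 0 < (i : ℕ)) (q : State) :
    step e n (.s i) q = .sink := by
  rcases q with _ | ⟨_ | _, m⟩ | m | m | m <;> simp [step, hi.ne']

theorem read_sink (w : FreeMonoid (Gen n)) : read e n w .sink = .sink := by
  induction w using FreeMonoid.inductionOn' with
  | one => exact read_one _
  | of_mul g w ih => rw [read_mul, read_of, step_sink, ih]

theorem read_alt_run {k m : ℕ} (b : Bool) (h : m + k < e) :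
    (m % 2 = 1 → read e n (alt (.of .t2) (.of .t1) k) (.run b m) = .run b (m + k)) ∧
    (m % 2 = 0 → read e n (alt (.of .t1) (.of .t2) k) (.run b m) = .run b (m + k)) := by
  induction k generalizing m with
  | zero => simp [alt, read_one]
  | succ k ih =>
    obtain ⟨h₁, h₂⟩ := @ih (m + 1) (by lia)
    rw [show m + (k + 1) = m + 1 + k by lia]
    constructor <;> intro hm
    · rw [alt, read_mul, read_of, step, if_pos ⟨hm, by lia⟩, h₂ (by lia)]
    · rw [alt, read_mul, read_of, step, if_pos ⟨hm, by lia⟩, h₁ (by lia)]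

theorem read_alt_run_eq_sink {k m : ℕ} (b : Bool) (hk : 0 < k) (h : e ≤ m + k) :
    read e n (alt (.of .t2) (.of .t1) k) (.run b m) = .sink ∧
    read e n (alt (.of .t1) (.of .t2) k) (.run b m) = .sink := by
  induction k generalizing m with
  | zero => lia
  | succ k ih =>
    simp only [alt, read_mul, read_of, step]
    constructor <;> split_ifs with hm
    · exact (ih (by lia) (by lia)).2
    · exact read_sink _
    · exact (ih (by lia) (by lia)).1
    · exact read_sink _

theorem read_eq_of_rel (he : 3 ≤ e) {u v : FreeMonoid (Gen n)} (h : Rel e n u v) (q : State) :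
    read e n u q = read e n v q := by
  cases h with
  | comm_ss i j h =>
    simp [read_mul, read_of, step_s_of_pos (show 0 < (j : ℕ) by lia), step_sink]
  | comm_t1s j h =>
    simp [read_mul, read_of, step_s_of_pos (show 0 < (j : ℕ) by lia), step_sink]
  | braid_ss i h =>
    have hs := step_s_of_pos (e := e) (i := ⟨(i : ℕ) + 1, h⟩) (Nat.succ_pos _)
    simp [read_mul, read_of, hs, step_sink]
  | alt_rel =>
    rcases q with _ | ⟨b, m⟩ | m | m | m
    · simp [read_sink]
    · have h := read_alt_run_eq_sink (n := n) b (show 0 < e by lia) (Nat.le_add_left e m)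
      rw [h.1, h.2]
    all_goals
      obtain ⟨k, rfl⟩ := Nat.exists_eq_add_of_le' he
      simp [alt, read_mul, read_of, step, read_sink]
  | braid_t2 h | braid_t1 h | long h =>
    simp only [read_mul, read_of]
    rcases q with _ | ⟨_ | _, m⟩ | m | m | m <;> simp only [step] <;> grind [step]

end read

theorem mk_w1_ne_mk_w2 (e n : ℕ) (he : 3 ≤ e) (h0 : 0 < n - 1) :
    mk e n (w1 e n h0) ≠ mk e n (w2 e n h0) := by
  intro h
  have hle : conGen (Rel e n) ≤ Con.ker (act e n) := Con.conGen_le.2 fun u v huv =>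
    MulOpposite.unop_injective (funext (read_eq_of_rel he huv))
  have hq : read e n (w1 e n h0) (.run false 0) = read e n (w2 e n h0) (.run false 0) :=
    congrArg (fun x => x.unop (State.run false 0)) (hle ((Con.eq _).1 h))
  have h₁ : read e n (w1 e n h0) (.run false 0) = .run true (1 + (e - 2)) := by
    have h := (read_alt_run (n := n) true (show 1 + (e - 2) < e by lia)).1 rfl
    simpa [w1, oT1, oT2, oS0, read_mul, read_of, step, show 1 < e by lia] using h
  have h₂ : read e n (w2 e n h0) (.run false 0) = .sink := by
    simp [w2, oT1, oT2, oS0, read_mul, read_of, step, read_sink]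
  simp [h₁, h₂] at hq

/-- For `e ≥ 3`, `n ≥ 2`: in the BMR monoid, the words `1·3·2·1·3·⟨21⟩^{e-2}` and
`3·2·1·3·⟨21⟩^{e-1}` become equal after left multiplication by `2`, yet they are
distinct; hence the BMR monoid is not left cancellative and does not embed in the
BMR braid group. -/
theorem bmr_monoid_not_left_cancellative (e n : ℕ) (he : 3 ≤ e) (hn : 2 ≤ n)
    (h0 : 0 < n - 1) :
    mk e n (oT2 n * w1 e n h0) = mk e n (oT2 n * w2 e n h0) ∧
    mk e n (w1 e n h0) ≠ mk e n (w2 e n h0) ∧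
    ¬ (∀ a b c : Mon e n, a * b = a * c → b = c) ∧
    (∀ f : Mon e n →* Grp e n,
      (∀ g : Gen n, f (mk e n (FreeMonoid.of g)) = PresentedGroup.of g) →
      ¬ Function.Injective f) := by
  have heq := mk_two_mul_w1_eq e n (by lia) h0
  have hne := mk_w1_ne_mk_w2 e n he h0
  rw [map_mul, map_mul] at heq
  refine ⟨by simpa only [map_mul] using heq, hne, fun hc => hne (hc _ _ _ heq),
    fun f _ hf => hne (hf ?_)⟩
  have hfeq := congrArg f heq
  rw [map_mul, map_mul] at hfeq
  exact mul_left_cancel hfeq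

end BMR
end

section
/- Assume e ≥ 3 and n ≥ 2. Let S be the set of BMR relations together with the additional relation 1·3·2·1·3·⟨21⟩^{e−2} = 3·2·1·3·⟨21⟩^{e−1} (this relation holds in the braid group, so the group presented by the BMR generators and S is still B(e,e,n+1)). In the monoid presented by the BMR generators and S: for every integer k ≥ 1, 2·1^k·3·2·1·3·⟨21⟩^{e−2} = 3·2·1·3·2^k·1·⟨21⟩^{e−2}; yet for every k ≥ 2 the words 2·1^k·3·2·1·3 and 3·2·1·3·2^k·1 represent distinct elements. Hence this monoid is not right cancellative. -/
namespace BMR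

/-- The BMR relations together with the extra relation
`1·3·2·1·3·⟨21⟩^{e-2} = 3·2·1·3·⟨21⟩^{e-1}`. -/
def SRel (e n : ℕ) (h0 : 0 < n - 1) :
    FreeMonoid (Gen n) → FreeMonoid (Gen n) → Prop :=
  fun u v => Rel e n u v ∨ (u = w1 e n h0 ∧ v = w2 e n h0)

/-- The monoid presented by the BMR generators and the augmented relation set `S`. -/
abbrev SMon (e n : ℕ) (h0 : 0 < n - 1) : Type := (conGen (SRel e n h0)).Quotient

/-- The canonical projection onto the monoid presented by `S`. -/
def mkS (e n : ℕ) (h0 : 0 < n - 1) : FreeMonoid (Gen n) →* SMon e n h0 := Con.mk' _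

theorem alt_succ_eq_mul {M : Type*} [Monoid M] (a b : M) (k : ℕ) :
    ∃ y, alt a b (k + 1) = alt a b k * y := by
  induction k generalizing a b with
  | zero => exact ⟨a, by simp [alt]⟩
  | succ k ih =>
    obtain ⟨y, hy⟩ := ih b a
    exact ⟨y, by rw [alt, hy, ← mul_assoc]; rfl⟩

/-- The braid relations `bcb = cbc` and `aca = cac` make `cbac` intertwine `b` and `a`. -/
theorem braid_intertwine {M : Type*} [Monoid M] {a b c : M} (hb : b * c * b = c * b * c)
    (ha : a * c * a = c * a * c) : b * (c * b * a * c) = c * b * a * c * a := by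
  calc b * (c * b * a * c) = b * c * b * (a * c) := by simp only [mul_assoc]
    _ = c * b * (c * a * c) := by rw [hb]; simp only [mul_assoc]
    _ = c * b * a * c * a := by rw [← ha]; simp only [mul_assoc]

theorem mul_alt_of_braid {G : Type*} [Group G] {a b c : G} {m : ℕ}
    (hb : b * c * b = c * b * c) (ha : a * c * a = c * a * c)
    (hlong : c * b * a * c * b * a = b * a * c * b * a * c)
    (halt : alt b a (m + 2) = alt a b (m + 2)) :
    a * c * b * a * c * alt b a m = c * b * a * c * alt b a (m + 1) := by
  have hd := braid_intertwine hb ha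
  have had : a * (c * b * a * c) = c * b * a * c * (a⁻¹ * b * a) := by
    apply mul_left_cancel (a := b)
    calc b * (a * (c * b * a * c)) = b * a * c * b * a * c := by simp only [mul_assoc]
      _ = c * b * a * c * a * (a⁻¹ * b * a) := by rw [← hlong]; group
      _ = b * (c * b * a * c * (a⁻¹ * b * a)) := by rw [← hd]; simp only [mul_assoc]
  have halt' : b * (a * alt b a m) = a * alt b a (m + 1) := halt
  calc a * c * b * a * c * alt b a m = a * (c * b * a * c) * alt b a m := by
        simp only [mul_assoc]
    _ = c * b * a * c * a⁻¹ * (b * (a * alt b a m)) := by rw [had]; simp only [mul_assoc]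
    _ = c * b * a * c * alt b a (m + 1) := by rw [halt']; group

theorem mul_pow_mul_alt {M : Type*} [Monoid M] {a b c : M} {m : ℕ}
    (hb : b * c * b = c * b * c) (ha : a * c * a = c * a * c)
    (halt : alt b a (m + 2) = alt a b (m + 2))
    (hw : a * c * b * a * c * alt b a m = c * b * a * c * alt b a (m + 1)) (k : ℕ) :
    b * a ^ k * c * b * a * c * alt b a m = c * b * a * c * b ^ k * a * alt b a m := by
  have hd := braid_intertwine hb ha
  obtain ⟨y, hy⟩ := alt_succ_eq_mul b a m
  have hmove : SemiconjBy (a * alt b a m) y b := by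
    have : b * (a * alt b a m) = a * alt b a (m + 1) := halt
    rw [SemiconjBy, this, hy, mul_assoc]
  have hslide : SemiconjBy (c * b * a * c * alt b a m) y a := by
    rw [SemiconjBy, mul_assoc, ← hy, ← hw]
    simp only [mul_assoc]
  calc b * a ^ k * c * b * a * c * alt b a m
      = b * (a ^ k * (c * b * a * c * alt b a m)) := by simp only [mul_assoc]
    _ = b * (c * b * a * c) * alt b a m * y ^ k := by
        rw [← (hslide.pow_right k).eq]; simp only [mul_assoc]
    _ = c * b * a * c * (a * alt b a m * y ^ k) := by rw [hd]; simp only [mul_assoc]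
    _ = c * b * a * c * b ^ k * a * alt b a m := by
        rw [(hmove.pow_right k).eq]; simp only [mul_assoc]

theorem mkG_eq_of_rel {e n : ℕ} {u v : FreeMonoid (Gen n)} (h : Rel e n u v) :
    mkG e n u = mkG e n v := by
  have hmk : mkG e n = (PresentedGroup.mk (grels e n)).comp (toFG n) := by
    ext g
    simp [mkG, toFG, PresentedGroup.of]
  have h1 : PresentedGroup.mk (grels e n) (toFG n u * (toFG n v)⁻¹) = 1 :=
    PresentedGroup.one_of_mem ⟨u, v, h, rfl⟩
  rw [map_mul, map_inv, mul_inv_eq_one] at h1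
  simpa [hmk] using h1

theorem mkS_eq_of_srel {e n : ℕ} {h0 : 0 < n - 1} {u v : FreeMonoid (Gen n)}
    (h : SRel e n h0 u v) : mkS e n h0 u = mkS e n h0 v :=
  (Con.eq _).2 (ConGen.Rel.of _ _ h)

/-- The syntactic congruence of a singleton `{w}`. -/
def syntacticCon {M : Type*} [Monoid M] (w : M) : Con M where
  r u v := ∀ x y, x * u * y = w ↔ x * v * y = w
  iseqv := ⟨fun _ _ _ => Iff.rfl, fun h x y => (h x y).symm,
    fun h h' x y => (h x y).trans (h' x y)⟩
  mul' {u v u' v'} h h' x y := by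
    have h1 := h x (u' * y)
    have h2 := h' (x * v) y
    simp only [mul_assoc] at h1 h2 ⊢
    exact h1.trans h2

/-- A word having no factor equal to a side of a relation is alone in its class. -/
theorem eq_of_conGen_of_forall_ne {M : Type*} [Monoid M] {r : M → M → Prop} {w w' : M}
    (hr : ∀ u v, r u v → ∀ x y, x * u * y ≠ w ∧ x * v * y ≠ w) (h : conGen r w w') :
    w' = w := by
  have hle : conGen r ≤ syntacticCon w :=
    Con.conGen_le.2 fun u v huv x y => iff_of_false (hr u v huv x y).1 (hr u v huv x y).2
  simpa using (hle h 1 1).1 (by simp)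

/-- The pairs of letters that occur consecutively in `2·1^k·3·2·1·3`. -/
inductive Adjacent {n : ℕ} (h0 : 0 < n - 1) : Gen n → Gen n → Prop
  | t2_t1 : Adjacent h0 Gen.t2 Gen.t1
  | t1_t1 : Adjacent h0 Gen.t1 Gen.t1
  | t1_s : Adjacent h0 Gen.t1 (Gen.s ⟨0, h0⟩)
  | s_t2 : Adjacent h0 (Gen.s ⟨0, h0⟩) Gen.t2

/-- The word `2·1^k·3·2·1·3` as a list of letters. -/
def pattern {n : ℕ} (h0 : 0 < n - 1) (k : ℕ) : List (Gen n) :=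
  Gen.t2 :: (List.replicate k Gen.t1 ++ [Gen.s ⟨0, h0⟩, Gen.t2, Gen.t1, Gen.s ⟨0, h0⟩])

theorem toList_of_pow {α : Type*} (a : α) (k : ℕ) :
    (FreeMonoid.of a ^ k).toList = List.replicate k a := by
  induction k with
  | zero => rfl
  | succ k ih => rw [pow_succ', FreeMonoid.toList_of_mul, ih, List.replicate_succ]

theorem isChain_pattern {n : ℕ} (h0 : 0 < n - 1) (k : ℕ) :
    (pattern h0 (k + 1)).IsChain (Adjacent h0) := by
  have htail : (List.replicate (k + 1) Gen.t1 ++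
      [Gen.s ⟨0, h0⟩, Gen.t2, Gen.t1, Gen.s ⟨0, h0⟩]).IsChain (Adjacent h0) := by
    rw [List.isChain_append]
    refine ⟨List.isChain_replicate_of_rel _ .t1_t1, ?_, ?_⟩
    · simp [Adjacent.s_t2, Adjacent.t2_t1, Adjacent.t1_s]
    · simp [List.getLast?_replicate, Adjacent.t1_s]
  exact List.IsChain.cons_cons .t2_t1 htail

theorem not_infix_pattern {n : ℕ} (h0 : 0 < n - 1) (k : ℕ) :
    ¬ [Gen.t2, Gen.t1, Gen.s ⟨0, h0⟩, Gen.t2] <:+: pattern h0 (k + 2) := by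
  classical
  rintro ⟨x, y, hxy⟩
  cases x with
  | nil => simp [pattern, List.replicate_succ] at hxy
  | cons g x =>
    have htail := congrArg (List.count Gen.t2) (List.cons.inj hxy).2
    simp [List.count_replicate] at htail
    omega

/-- A sufficient condition for not being a factor of `2·1^k·3·2·1·3` with `k ≥ 2`: a forbidden pair of
consecutive letters or the factor `2·1·3·2`. -/
def Avoided {n : ℕ} (h0 : 0 < n - 1) (u : FreeMonoid (Gen n)) : Prop :=
  ¬ u.toList.IsChain (Adjacent h0) ∨ [Gen.t2, Gen.t1, Gen.s ⟨0, h0⟩, Gen.t2] <:+: u.toList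

theorem Avoided.mul_mul_ne {n : ℕ} {h0 : 0 < n - 1} {u : FreeMonoid (Gen n)}
    (h : Avoided h0 u) (k : ℕ) (x y : FreeMonoid (Gen n)) :
    x * u * y ≠ FreeMonoid.ofList (pattern h0 (k + 2)) := by
  intro hxy
  have hinf : u.toList <:+: pattern h0 (k + 2) := ⟨x.toList, y.toList, hxy⟩
  rcases h with h | h
  · exact h ((isChain_pattern h0 (k + 1)).infix hinf)
  · exact not_infix_pattern h0 k (h.trans hinf)

theorem SRel.avoided {e n : ℕ} {h0 : 0 < n - 1} {u v : FreeMonoid (Gen n)} (he : 3 ≤ e)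
    (h : SRel e n h0 u v) : Avoided h0 u ∧ Avoided h0 v := by
  obtain ⟨m, rfl⟩ := Nat.exists_eq_add_of_le' he
  rcases h with h | ⟨rfl, rfl⟩
  · cases h with
    | comm_ss i j h => constructor <;> left <;> rintro (_ | _ | ⟨⟨⟩, _⟩)
    | comm_t1s j h =>
      constructor <;> left
      · rintro (_ | _ | ⟨⟨⟩, _⟩)
        simp at h
      · rintro (_ | _ | ⟨⟨⟩, _⟩)
    | alt_rel =>
      constructor <;> left
      · rintro (_ | _ | ⟨_, _ | _ | ⟨⟨⟩, _⟩⟩)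
      · rintro (_ | _ | ⟨⟨⟩, _⟩)
    | braid_t2 h =>
      constructor <;> left
      · rintro (_ | _ | ⟨⟨⟩, _⟩)
      · rintro (_ | _ | ⟨_, _ | _ | ⟨⟨⟩, _⟩⟩)
    | braid_ss i h => constructor <;> left <;> rintro (_ | _ | ⟨⟨⟩, _⟩)
    | braid_t1 h =>
      constructor <;> left
      · rintro (_ | _ | ⟨_, _ | _ | ⟨⟨⟩, _⟩⟩)
      · rintro (_ | _ | ⟨⟨⟩, _⟩)
    | long h =>
      exact ⟨.inr ⟨[Gen.s ⟨0, h⟩], [Gen.t1], rfl⟩, .inr ⟨[], [Gen.t1, Gen.s ⟨0, h⟩], rfl⟩⟩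
  · exact ⟨.inr ⟨[Gen.t1, Gen.s ⟨0, h0⟩], (alt (oT1 n) (oT2 n) m).toList, rfl⟩,
      .inr ⟨[Gen.s ⟨0, h0⟩], (alt (oT1 n) (oT2 n) (m + 1)).toList, rfl⟩⟩

/-- For `e ≥ 3`, `n ≥ 2`: the extra relation holds in the BMR braid group; in the
monoid presented by the augmented relation set `S`, for every `k ≥ 1` one has
`2·1^k·3·2·1·3·⟨21⟩^{e-2} = 3·2·1·3·2^k·1·⟨21⟩^{e-2}`, yet for every `k ≥ 2` the
words `2·1^k·3·2·1·3` and `3·2·1·3·2^k·1` are distinct; hence this monoid is not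
right cancellative. -/
theorem augmented_bmr_monoid_not_right_cancellative (e n : ℕ) (he : 3 ≤ e)
    (hn : 2 ≤ n) (h0 : 0 < n - 1) :
    mkG e n (w1 e n h0) = mkG e n (w2 e n h0) ∧
    (∀ k : ℕ, 1 ≤ k →
      mkS e n h0 (oT2 n * (oT1 n) ^ k * oS0 n h0 * oT2 n * oT1 n * oS0 n h0 *
          alt (oT2 n) (oT1 n) (e - 2)) =
      mkS e n h0 (oS0 n h0 * oT2 n * oT1 n * oS0 n h0 * (oT2 n) ^ k * oT1 n *
          alt (oT2 n) (oT1 n) (e - 2))) ∧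
    (∀ k : ℕ, 2 ≤ k →
      mkS e n h0 (oT2 n * (oT1 n) ^ k * oS0 n h0 * oT2 n * oT1 n * oS0 n h0) ≠
      mkS e n h0 (oS0 n h0 * oT2 n * oT1 n * oS0 n h0 * (oT2 n) ^ k * oT1 n)) ∧
    ¬ (∀ a b c : SMon e n h0, b * a = c * a → b = c) := by
  obtain ⟨m, rfl⟩ := Nat.exists_eq_add_of_le' (Nat.le_of_succ_le he)
  rw [Nat.add_sub_cancel]
  have hpow : ∀ k : ℕ,
      mkS (m + 2) n h0 (oT2 n * (oT1 n) ^ k * oS0 n h0 * oT2 n * oT1 n * oS0 n h0 *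
        alt (oT2 n) (oT1 n) m) =
      mkS (m + 2) n h0 (oS0 n h0 * oT2 n * oT1 n * oS0 n h0 * (oT2 n) ^ k * oT1 n *
        alt (oT2 n) (oT1 n) m) := by
    intro k
    have hb := mkS_eq_of_srel (h0 := h0) (.inl (Rel.braid_t2 (e := m + 2) h0))
    have ha := mkS_eq_of_srel (h0 := h0) (.inl (Rel.braid_t1 (e := m + 2) h0))
    have halt := mkS_eq_of_srel (h0 := h0) (.inl (Rel.alt_rel (e := m + 2) (n := n)))
    have hw := mkS_eq_of_srel (e := m + 2) (h0 := h0) (.inr ⟨rfl, rfl⟩)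
    simp only [w1, w2, Nat.add_sub_cancel, map_mul, map_pow, map_alt,
      show m + 2 - 1 = m + 1 from rfl] at hb ha halt hw ⊢
    exact mul_pow_mul_alt hb ha halt hw k
  have hne : ∀ k : ℕ, 2 ≤ k →
      mkS (m + 2) n h0 (oT2 n * (oT1 n) ^ k * oS0 n h0 * oT2 n * oT1 n * oS0 n h0) ≠
      mkS (m + 2) n h0 (oS0 n h0 * oT2 n * oT1 n * oS0 n h0 * (oT2 n) ^ k * oT1 n) := by
    intro k hk h
    obtain ⟨k, rfl⟩ := Nat.exists_eq_add_of_le' hk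
    have hword : oT2 n * (oT1 n) ^ (k + 2) * oS0 n h0 * oT2 n * oT1 n * oS0 n h0 =
        FreeMonoid.ofList (pattern h0 (k + 2)) := by
      apply FreeMonoid.toList.injective
      simp [oT1, oT2, oS0, pattern, toList_of_pow]
    have heq := eq_of_conGen_of_forall_ne (fun u v huv x y => by
      rw [hword]
      exact ⟨(huv.avoided he).1.mul_mul_ne k x y, (huv.avoided he).2.mul_mul_ne k x y⟩)
      ((Con.eq _).1 h)
    have hhead := congrArg (fun w => w.toList.head?) heq
    simp [oT1, oT2, oS0] at hhead
  refine ⟨?_, fun k _ => hpow k, hne, fun hcancel => hne 2 le_rfl ?_⟩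
  · have hb := mkG_eq_of_rel (Rel.braid_t2 (e := m + 2) h0)
    have ha := mkG_eq_of_rel (Rel.braid_t1 (e := m + 2) h0)
    have hlong := mkG_eq_of_rel (Rel.long (e := m + 2) h0)
    have halt := mkG_eq_of_rel (Rel.alt_rel (e := m + 2) (n := n))
    simp only [w1, w2, Nat.add_sub_cancel, map_mul, map_alt,
      show m + 2 - 1 = m + 1 from rfl] at hb ha hlong halt ⊢
    exact mul_alt_of_braid hb ha hlong halt
  · apply hcancel (mkS (m + 2) n h0 (alt (oT2 n) (oT1 n) m))
    rw [← map_mul, ← map_mul]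
    exact hpow 2

end BMR
end
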